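/- (Lipschitz estimate for gradients of Picard iterates with geometrically decaying dependence on u.) Assume f ∈ C¹ with ∇_x f and ∇_θ f Lipschitz continuous. Then the map (x,θ,u) ↦ ∇_{x,θ}(P_{t₀,x,θ} u) is Lipschitz continuous on X × Θ × C_a, and there exist q < 1, K > 0, and N ∈ ℕ such that for all n ≥ N, all (x₁,θ₁),(x₂,θ₂) ∈ X × Θ, and all u₁, u₂ ∈ C_a: ‖∇_{x,θ}(P_{t₀,x₁,θ₁}^n u₁) − ∇_{x,θ}(P_{t₀,x₂,θ₂}^n u₂)‖_∞ ≤ q^n·‖u₁ − u₂‖_∞ + K·‖x₁ − x₂‖₂ + K·‖θ₁ − θ₂‖₂. -/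

import Mathlib

open Set MeasureTheory Filter Topology Metric

noncomputable section

/-- Euclidean space `ℝ^n`. -/
abbrev Euc (n : ℕ) : Type := EuclideanSpace ℝ (Fin n)

/-- The Picard operator `(P_{t₀,x,θ} u)(t) = x + ∫₀ᵗ f(s + t₀, u(s), θ) ds`. -/
noncomputable def picard {nx nθ : ℕ} (f : ℝ → Euc nx → Euc nθ → Euc nx)
    (t₀ : ℝ) (x : Euc nx) (θ : Euc nθ) (u : ℝ → Euc nx) : ℝ → Euc nx :=
  fun t => x + ∫ s in (0:ℝ)..t, f (s + t₀) (u s) θ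

/-- Membership in `C_a = {u ∈ C([0,T],ℝ^{nx}) : sup_{t∈[0,T]} ‖u t‖ ≤ a}`. -/
def InCa {nx : ℕ} (T a : ℝ) (u : ℝ → Euc nx) : Prop :=
  ContinuousOn u (Icc 0 T) ∧ ∀ t ∈ Icc (0:ℝ) T, ‖u t‖ ≤ a

/-- Sup norm over `[0,T]`. -/
noncomputable def supIcc {nx : ℕ} (T : ℝ) (u : ℝ → Euc nx) : ℝ :=
  ⨆ t : Icc (0:ℝ) T, ‖u t‖

/-- Differentiation under an interval integral whose integrand has a jointly continuous
derivative in the parameter. -/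
theorem hasFDerivAt_intervalIntegral_of_continuous {E F : Type*}
    [NormedAddCommGroup E] [NormedSpace ℝ E] [ProperSpace E]
    [NormedAddCommGroup F] [NormedSpace ℝ F]
    {g : E → ℝ → F} {g' : E → ℝ → E →L[ℝ] F} (hg : ∀ p, Continuous (g p))
    (hg' : Continuous (Function.uncurry g')) {b c : ℝ}
    (hd : ∀ s ∈ uIcc b c, ∀ p, HasFDerivAt (fun p => g p s) (g' p s) p) (p : E) :
    HasFDerivAt (fun p => ∫ s in b..c, g p s) (∫ s in b..c, g' p s) p := by
  obtain ⟨C, hC⟩ := ((isCompact_closedBall p 1).prod (isCompact_uIcc (a := b) (b := c))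
    ).exists_bound_of_continuousOn hg'.continuousOn
  refine intervalIntegral.hasFDerivAt_integral_of_dominated_of_fderiv_le (F' := g')
    (bound := fun _ => C) (closedBall_mem_nhds p one_pos)
    (Eventually.of_forall fun q => (hg q).aestronglyMeasurable)
    ((hg p).intervalIntegrable _ _)
    (hg'.comp (Continuous.prodMk_right p)).aestronglyMeasurable
    (Eventually.of_forall fun s hs q hq => hC (q, s) ⟨hq, uIoc_subset_uIcc hs⟩)
    intervalIntegrable_const
    (Eventually.of_forall fun s hs q _ => hd s (uIoc_subset_uIcc hs) q)

/-- An interval integral over a subinterval `[0, t]` of `[0, T]` is bounded by `T` times a bound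
on the integrand. -/
theorem norm_integral_le_mul_of_norm_le {F : Type*} [NormedAddCommGroup F] [NormedSpace ℝ F]
    {g : ℝ → F} {T t C : ℝ} (ht : t ∈ Icc 0 T) (hC : ∀ s ∈ Icc 0 T, ‖g s‖ ≤ C) :
    ‖∫ s in (0:ℝ)..t, g s‖ ≤ T * C := by
  have hC0 : 0 ≤ C := (norm_nonneg _).trans (hC t ht)
  have h := intervalIntegral.norm_integral_le_of_norm_le_const (a := 0) (b := t) (f := g) (C := C)
    fun s hs => by
      rw [uIoc_of_le ht.1] at hs
      exact hC s ⟨hs.1.le, hs.2.trans ht.2⟩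
  rw [sub_zero, abs_of_nonneg ht.1] at h
  calc _ ≤ C * t := h
    _ ≤ C * T := mul_le_mul_of_nonneg_left ht.2 hC0
    _ = T * C := mul_comm _ _

section Picard

variable {nx nθ : ℕ} {f : ℝ → Euc nx → Euc nθ → Euc nx}
  {f' : ℝ → Euc nx → Euc nθ → (Euc nx × Euc nθ →L[ℝ] Euc nx)} {t₀ T a : ℝ}

theorem picard_iterate_eqOn {x : Euc nx} {θ : Euc nθ} {u v : ℝ → Euc nx}
    (h : EqOn u v (Icc 0 T)) (n : ℕ) :
    EqOn ((picard f t₀ x θ)^[n] u) ((picard f t₀ x θ)^[n] v) (Icc 0 T) := by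
  induction n with
  | zero => exact h
  | succ n ih =>
    intro t ht
    simp only [Function.iterate_succ_apply', picard]
    congr 1
    refine intervalIntegral.integral_congr fun s hs => ?_
    rw [uIcc_of_le ht.1] at hs
    simp only [ih ⟨hs.1, hs.2.trans ht.2⟩]

theorem continuous_picard_iterate
    (hfc : Continuous fun p : ℝ × Euc nx × Euc nθ => f p.1 p.2.1 p.2.2)
    {u : ℝ → Euc nx} (hu : Continuous u) (n : ℕ) :
    Continuous fun q : (Euc nx × Euc nθ) × ℝ => (picard f t₀ q.1.1 q.1.2)^[n] u q.2 := by
  induction n with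
  | zero => exact hu.comp continuous_snd
  | succ n ih =>
    simp only [Function.iterate_succ_apply', picard]
    refine continuous_fst.fst.add
      (intervalIntegral.continuous_parametric_intervalIntegral_of_continuous
        (f := fun (q : (Euc nx × Euc nθ) × ℝ) s =>
          f (s + t₀) ((picard f t₀ q.1.1 q.1.2)^[n] u s) q.1.2) ?_ continuous_snd)
    have h1 : Continuous fun z : ((Euc nx × Euc nθ) × ℝ) × ℝ =>
        (picard f t₀ z.1.1.1 z.1.1.2)^[n] u z.2 :=
      ih.comp (continuous_fst.fst.prodMk continuous_snd)
    exact hfc.comp ((continuous_snd.add continuous_const).prodMk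
      (h1.prodMk continuous_fst.fst.snd))

variable (f f' t₀) in
/-- The derivative of `(x, θ) ↦ (P^n_{t₀,x,θ} u)(t)`, obtained by differentiating the Picard
recursion. -/
noncomputable def picardFDeriv (u : ℝ → Euc nx) :
    ℕ → ℝ → Euc nx × Euc nθ → (Euc nx × Euc nθ →L[ℝ] Euc nx)
  | 0, _, _ => 0
  | n + 1, t, p => ContinuousLinearMap.fst ℝ (Euc nx) (Euc nθ) +
      ∫ s in (0:ℝ)..t, (f' (s + t₀) ((picard f t₀ p.1 p.2)^[n] u s) p.2).comp
        ((picardFDeriv u n s p).prod (ContinuousLinearMap.snd ℝ (Euc nx) (Euc nθ)))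

theorem continuous_picardFDeriv_integrand
    (hfc : Continuous fun p : ℝ × Euc nx × Euc nθ => f p.1 p.2.1 p.2.2)
    (hf'c : Continuous fun p : ℝ × Euc nx × Euc nθ => f' p.1 p.2.1 p.2.2)
    {u : ℝ → Euc nx} (hu : Continuous u) {n : ℕ}
    (h : Continuous fun q : (Euc nx × Euc nθ) × ℝ => picardFDeriv f f' t₀ u n q.2 q.1) :
    Continuous fun q : (Euc nx × Euc nθ) × ℝ =>
      (f' (q.2 + t₀) ((picard f t₀ q.1.1 q.1.2)^[n] u q.2) q.1.2).comp
        ((picardFDeriv f f' t₀ u n q.2 q.1).prod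
          (ContinuousLinearMap.snd ℝ (Euc nx) (Euc nθ))) := by
  have h1 : Continuous fun q : (Euc nx × Euc nθ) × ℝ =>
      f' (q.2 + t₀) ((picard f t₀ q.1.1 q.1.2)^[n] u q.2) q.1.2 :=
    hf'c.comp ((continuous_snd.add continuous_const).prodMk
      ((continuous_picard_iterate hfc hu n).prodMk continuous_fst.snd))
  have h2 : Continuous fun q : (Euc nx × Euc nθ) × ℝ =>
      (picardFDeriv f f' t₀ u n q.2 q.1).prod
        (ContinuousLinearMap.snd ℝ (Euc nx) (Euc nθ)) :=
    (ContinuousLinearMap.prodₗᵢ (𝕜 := ℝ) (E := Euc nx × Euc nθ)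
      (F := Euc nx) (G := Euc nθ) ℝ).continuous.comp (h.prodMk continuous_const)
  exact h1.clm_comp h2

theorem continuous_picardFDeriv
    (hfc : Continuous fun p : ℝ × Euc nx × Euc nθ => f p.1 p.2.1 p.2.2)
    (hf'c : Continuous fun p : ℝ × Euc nx × Euc nθ => f' p.1 p.2.1 p.2.2)
    {u : ℝ → Euc nx} (hu : Continuous u) (n : ℕ) :
    Continuous fun q : (Euc nx × Euc nθ) × ℝ => picardFDeriv f f' t₀ u n q.2 q.1 := by
  induction n with
  | zero => exact continuous_const
  | succ n ih =>
    refine continuous_const.add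
      (intervalIntegral.continuous_parametric_intervalIntegral_of_continuous
        (f := fun (q : (Euc nx × Euc nθ) × ℝ) s =>
          (f' (s + t₀) ((picard f t₀ q.1.1 q.1.2)^[n] u s) q.1.2).comp
            ((picardFDeriv f f' t₀ u n s q.1).prod
              (ContinuousLinearMap.snd ℝ (Euc nx) (Euc nθ)))) ?_ continuous_snd)
    exact (continuous_picardFDeriv_integrand hfc hf'c hu ih).comp
      (continuous_fst.fst.prodMk continuous_snd)

theorem hasFDerivAt_picard_iterate
    (hfc : Continuous fun p : ℝ × Euc nx × Euc nθ => f p.1 p.2.1 p.2.2)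
    (hf' : ∀ t x θ, HasFDerivAt (fun p : Euc nx × Euc nθ => f t p.1 p.2) (f' t x θ) (x, θ))
    (hf'c : Continuous fun p : ℝ × Euc nx × Euc nθ => f' p.1 p.2.1 p.2.2)
    {u : ℝ → Euc nx} (hu : Continuous u) (n : ℕ) (t : ℝ) (p : Euc nx × Euc nθ) :
    HasFDerivAt (fun p : Euc nx × Euc nθ => (picard f t₀ p.1 p.2)^[n] u t)
      (picardFDeriv f f' t₀ u n t p) p := by
  induction n generalizing t p with
  | zero => exact hasFDerivAt_const _ _
  | succ n ih =>
    simp only [Function.iterate_succ_apply', picard]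
    refine hasFDerivAt_fst.add (hasFDerivAt_intervalIntegral_of_continuous
      (g := fun (p : Euc nx × Euc nθ) s => f (s + t₀) ((picard f t₀ p.1 p.2)^[n] u s) p.2)
      (g' := fun p s => (f' (s + t₀) ((picard f t₀ p.1 p.2)^[n] u s) p.2).comp
        ((picardFDeriv f f' t₀ u n s p).prod (ContinuousLinearMap.snd ℝ (Euc nx) (Euc nθ))))
      (fun p => ?_) ?_ (fun s _ p => ?_) p)
    · exact hfc.comp ((continuous_id.add continuous_const).prodMk
        (((continuous_picard_iterate hfc hu n).comp (Continuous.prodMk_right p)).prodMk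
          continuous_const))
    · exact continuous_picardFDeriv_integrand hfc hf'c hu
        (continuous_picardFDeriv hfc hf'c hu n)
    · exact (hf' (s + t₀) ((picard f t₀ p.1 p.2)^[n] u s) p.2).comp p
        ((ih s p).prodMk hasFDerivAt_snd)

/-- Picard iterates starting in `C_a` stay in `C_a`. -/
theorem norm_picard_iterate_le {M : ℝ} {x : Euc nx} {θ : Euc nθ} (hx : 2 * ‖x‖ ≤ a)
    (hTM : 2 * M * T < a)
    (hM : ∀ s ∈ Icc 0 T, ∀ y ∈ closedBall (0 : Euc nx) a, ‖f (s + t₀) y θ‖ ≤ M)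
    {u : ℝ → Euc nx} (hu : ∀ t ∈ Icc 0 T, ‖u t‖ ≤ a) (n : ℕ) :
    ∀ t ∈ Icc 0 T, ‖(picard f t₀ x θ)^[n] u t‖ ≤ a := by
  induction n with
  | zero => exact hu
  | succ n ih =>
    intro t ht
    simp only [Function.iterate_succ_apply', picard]
    have h := norm_integral_le_mul_of_norm_le ht
      fun s hs => hM s hs _ (mem_closedBall_zero_iff.2 (ih s hs))
    linarith [norm_add_le x (∫ s in (0:ℝ)..t, f (s + t₀) ((picard f t₀ x θ)^[n] u s) θ)]

/-- A Lipschitz bound in `x` on a closed ball bounds the partial derivative in `x` there. -/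
theorem norm_comp_inl_le_of_lipschitz {E F G : Type*}
    [NormedAddCommGroup E] [NormedSpace ℝ E] [NormedAddCommGroup F] [NormedSpace ℝ F]
    [NormedAddCommGroup G] [NormedSpace ℝ G] {g : E → F → G} {g' : E → F → (E × F →L[ℝ] G)}
    {θ : F} {L : ℝ} (hL : 0 ≤ L) (ha : a ≠ 0)
    (hg : ∀ x, HasFDerivAt (fun p : E × F => g p.1 p.2) (g' x θ) (x, θ))
    (hg' : Continuous fun x => g' x θ)
    (hlip : ∀ x ∈ closedBall (0 : E) a, ∀ y ∈ closedBall (0 : E) a,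
      ‖g x θ - g y θ‖ ≤ L * ‖x - y‖) {x : E} (hx : x ∈ closedBall (0 : E) a) :
    ‖(g' x θ).comp (ContinuousLinearMap.inl ℝ E F)‖ ≤ L := by
  rw [← closure_ball 0 ha] at hx
  refine closure_minimal (s := ball (0 : E) a)
    (t := {x | ‖(g' x θ).comp (ContinuousLinearMap.inl ℝ E F)‖ ≤ L}) (fun y hy => ?_)
    (isClosed_le (hg'.clm_comp continuous_const).norm continuous_const) hx
  have h : HasFDerivAt (fun z => g z θ) ((g' y θ).comp (ContinuousLinearMap.inl ℝ E F)) y :=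
    HasFDerivAt.comp (f := fun z => (z, θ)) (g := fun p : E × F => g p.1 p.2) y (hg y)
      (hasFDerivAt_prodMk_left y θ)
  refine h.le_of_lip' hL ?_
  filter_upwards [isOpen_ball.mem_nhds hy] with z hz
  exact hlip z (ball_subset_closedBall hz) y (ball_subset_closedBall hy)

/-- A bound on the derivative over a ball of parameters gives a Lipschitz bound in `θ`. -/
theorem norm_sub_le_of_norm_fderiv_le {E F G : Type*}
    [NormedAddCommGroup E] [NormedSpace ℝ E] [NormedAddCommGroup F] [NormedSpace ℝ F]
    [NormedAddCommGroup G] [NormedSpace ℝ G] {g : E → F → G} {g' : E → F → (E × F →L[ℝ] G)}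
    {x : E} {R C : ℝ} (hg : ∀ θ, HasFDerivAt (fun p : E × F => g p.1 p.2) (g' x θ) (x, θ))
    (hC : ∀ θ ∈ closedBall (0 : F) R, ‖g' x θ‖ ≤ C) {θ₁ θ₂ : F}
    (h₁ : θ₁ ∈ closedBall (0 : F) R) (h₂ : θ₂ ∈ closedBall (0 : F) R) :
    ‖g x θ₁ - g x θ₂‖ ≤ C * ‖θ₁ - θ₂‖ := by
  refine (convex_closedBall (0 : F) R).norm_image_sub_le_of_norm_hasFDerivWithin_le
    (f := fun θ => g x θ) (f' := fun θ => (g' x θ).comp (ContinuousLinearMap.inr ℝ E F))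
    (fun θ _ => ((hg θ).comp θ (hasFDerivAt_prodMk_right x θ)).hasFDerivWithinAt)
    (fun θ hθ => ?_) h₂ h₁
  calc _ ≤ ‖g' x θ‖ * ‖ContinuousLinearMap.inr ℝ E F‖ := ContinuousLinearMap.opNorm_comp_le _ _
    _ ≤ ‖g' x θ‖ * 1 := by gcongr; exact ContinuousLinearMap.norm_inr_le_one ℝ E F
    _ ≤ C := by rw [mul_one]; exact hC θ hθ

theorem norm_comp_prod_snd_le {E F G : Type*}
    [NormedAddCommGroup E] [NormedSpace ℝ E] [NormedAddCommGroup F] [NormedSpace ℝ F]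
    [NormedAddCommGroup G] [NormedSpace ℝ G] {A : E × F →L[ℝ] G} {D : E × F →L[ℝ] E}
    {L C : ℝ} (hL : ‖A.comp (ContinuousLinearMap.inl ℝ E F)‖ ≤ L) (hC : ‖A‖ ≤ C) :
    ‖A.comp (D.prod (ContinuousLinearMap.snd ℝ E F))‖ ≤ L * ‖D‖ + C := by
  have h : A.comp (D.prod (ContinuousLinearMap.snd ℝ E F)) =
      (A.comp (ContinuousLinearMap.inl ℝ E F)).comp D +
        A.comp ((0 : E × F →L[ℝ] E).prod (ContinuousLinearMap.snd ℝ E F)) := by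
    ext v <;> simp [← map_add]
  have h1 : ‖(0 : E × F →L[ℝ] E).prod (ContinuousLinearMap.snd ℝ E F)‖ ≤ 1 := by
    rw [ContinuousLinearMap.opNorm_prod, Prod.norm_def]
    simpa using ContinuousLinearMap.norm_snd_le ℝ E F
  rw [h]
  calc _ ≤ ‖A.comp (ContinuousLinearMap.inl ℝ E F)‖ * ‖D‖ +
        ‖A‖ * ‖(0 : E × F →L[ℝ] E).prod (ContinuousLinearMap.snd ℝ E F)‖ :=
        (norm_add_le _ _).trans (add_le_add (ContinuousLinearMap.opNorm_comp_le _ _)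
          (ContinuousLinearMap.opNorm_comp_le _ _))
    _ ≤ L * ‖D‖ + ‖A‖ * 1 := by gcongr
    _ ≤ L * ‖D‖ + C := by linarith

theorem norm_comp_prod_snd_sub_le {E F G : Type*}
    [NormedAddCommGroup E] [NormedSpace ℝ E] [NormedAddCommGroup F] [NormedSpace ℝ F]
    [NormedAddCommGroup G] [NormedSpace ℝ G] {A₁ A₂ : E × F →L[ℝ] G} {D₁ D₂ : E × F →L[ℝ] E}
    {L : ℝ} (hL : ‖A₂.comp (ContinuousLinearMap.inl ℝ E F)‖ ≤ L) :
    ‖A₁.comp (D₁.prod (ContinuousLinearMap.snd ℝ E F)) -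
        A₂.comp (D₂.prod (ContinuousLinearMap.snd ℝ E F))‖ ≤
      ‖A₁ - A₂‖ * (‖D₁‖ + 1) + L * ‖D₁ - D₂‖ := by
  have h : A₁.comp (D₁.prod (ContinuousLinearMap.snd ℝ E F)) -
        A₂.comp (D₂.prod (ContinuousLinearMap.snd ℝ E F)) =
      (A₁ - A₂).comp (D₁.prod (ContinuousLinearMap.snd ℝ E F)) +
        (A₂.comp (ContinuousLinearMap.inl ℝ E F)).comp (D₁ - D₂) := by
    refine ContinuousLinearMap.ext fun v => ?_
    have hv : A₂ (D₁ v - D₂ v, 0) = A₂ (D₁ v, v.2) - A₂ (D₂ v, v.2) := by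
      rw [← map_sub, Prod.mk_sub_mk, sub_self]
    change A₁ (D₁ v, v.2) - A₂ (D₂ v, v.2) =
      A₁ (D₁ v, v.2) - A₂ (D₁ v, v.2) + A₂ (D₁ v - D₂ v, 0)
    rw [hv, sub_add_sub_cancel]
  have h1 : ‖D₁.prod (ContinuousLinearMap.snd ℝ E F)‖ ≤ ‖D₁‖ + 1 := by
    rw [ContinuousLinearMap.opNorm_prod, Prod.norm_def]
    have := ContinuousLinearMap.norm_snd_le ℝ E F
    exact max_le (by simp) (by linarith [norm_nonneg D₁])
  rw [h]
  calc _ ≤ ‖A₁ - A₂‖ * ‖D₁.prod (ContinuousLinearMap.snd ℝ E F)‖ +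
        ‖A₂.comp (ContinuousLinearMap.inl ℝ E F)‖ * ‖D₁ - D₂‖ :=
        (norm_add_le _ _).trans (add_le_add (ContinuousLinearMap.opNorm_comp_le _ _)
          (ContinuousLinearMap.opNorm_comp_le _ _))
    _ ≤ _ := by gcongr

/-- Geometric contraction of Picard iterates, up to a Lipschitz error in `(x, θ)`. -/
theorem norm_picard_iterate_sub_le
    (hfc : Continuous fun p : ℝ × Euc nx × Euc nθ => f p.1 p.2.1 p.2.2)
    {L C r A δ : ℝ} (hT : 0 ≤ T) (hr : T * L ≤ r) (hL : 0 ≤ L) (hC : 0 ≤ C) (hδ : 0 ≤ δ)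
    (hr0 : 0 ≤ r) (hA0 : 0 ≤ A) (hA : 1 + T * C + r * A ≤ A) {p₁ p₂ : Euc nx × Euc nθ}
    (hlip : ∀ s ∈ Icc 0 T, ∀ x ∈ closedBall (0 : Euc nx) a, ∀ y ∈ closedBall (0 : Euc nx) a,
      ‖f (s + t₀) x p₁.2 - f (s + t₀) y p₂.2‖ ≤ L * ‖x - y‖ + C * ‖p₁.2 - p₂.2‖)
    {u₁ u₂ : ℝ → Euc nx} (hu₁ : Continuous u₁) (hu₂ : Continuous u₂)
    (hU₁ : ∀ n, ∀ t ∈ Icc 0 T, ‖(picard f t₀ p₁.1 p₁.2)^[n] u₁ t‖ ≤ a)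
    (hU₂ : ∀ n, ∀ t ∈ Icc 0 T, ‖(picard f t₀ p₂.1 p₂.2)^[n] u₂ t‖ ≤ a)
    (hu : ∀ t ∈ Icc 0 T, ‖u₁ t - u₂ t‖ ≤ δ) (n : ℕ) :
    ∀ t ∈ Icc 0 T,
      ‖(picard f t₀ p₁.1 p₁.2)^[n] u₁ t - (picard f t₀ p₂.1 p₂.2)^[n] u₂ t‖ ≤
        r ^ n * δ + A * (‖p₁.1 - p₂.1‖ + ‖p₁.2 - p₂.2‖) := by
  induction n with
  | zero =>
    intro t ht
    have : 0 ≤ A * (‖p₁.1 - p₂.1‖ + ‖p₁.2 - p₂.2‖) := by positivity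
    simpa using (hu t ht).trans (by linarith)
  | succ n ih =>
    intro t ht
    have hc : ∀ (p : Euc nx × Euc nθ) {u : ℝ → Euc nx}, Continuous u →
        Continuous fun s => f (s + t₀) ((picard f t₀ p.1 p.2)^[n] u s) p.2 := fun p u hu =>
      hfc.comp ((continuous_id.add continuous_const).prodMk
        (((continuous_picard_iterate hfc hu n).comp (Continuous.prodMk_right p)).prodMk
          continuous_const))
    simp only [Function.iterate_succ_apply', picard]
    rw [add_sub_add_comm, ← intervalIntegral.integral_sub
      ((hc p₁ hu₁).intervalIntegrable _ _) ((hc p₂ hu₂).intervalIntegrable _ _)]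
    set X := ‖p₁.1 - p₂.1‖
    set Y := ‖p₁.2 - p₂.2‖
    have hX : 0 ≤ X := norm_nonneg _
    have hY : 0 ≤ Y := norm_nonneg _
    have h := norm_integral_le_mul_of_norm_le ht fun s hs =>
      (hlip s hs _ (mem_closedBall_zero_iff.2 (hU₁ n s hs)) _
        (mem_closedBall_zero_iff.2 (hU₂ n s hs))).trans
        (add_le_add_left (mul_le_mul_of_nonneg_left (ih s hs) hL) _)
    have h1 : T * L * (r ^ n * δ + A * (X + Y)) ≤ r * (r ^ n * δ + A * (X + Y)) := by gcongr
    have h2 : (1 + T * C + r * A) * (X + Y) ≤ A * (X + Y) := by gcongr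
    have h3 : 0 ≤ T * C * X := by positivity
    refine (norm_add_le _ _).trans ((add_le_add_right h _).trans ?_)
    rw [pow_succ]
    linarith

/-- The derivatives of the Picard iterates are uniformly bounded. -/
theorem norm_picardFDeriv_le {L C r A : ℝ} (hr : T * L ≤ r) (hL : 0 ≤ L)
    (hA0 : 0 ≤ A) (hA : 1 + T * C + r * A ≤ A) {p : Euc nx × Euc nθ}
    (hf'L : ∀ s ∈ Icc 0 T, ∀ x ∈ closedBall (0 : Euc nx) a,
      ‖(f' (s + t₀) x p.2).comp (ContinuousLinearMap.inl ℝ (Euc nx) (Euc nθ))‖ ≤ L)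
    (hf'C : ∀ s ∈ Icc 0 T, ∀ x ∈ closedBall (0 : Euc nx) a, ‖f' (s + t₀) x p.2‖ ≤ C)
    {u : ℝ → Euc nx}
    (hU : ∀ n, ∀ t ∈ Icc 0 T, ‖(picard f t₀ p.1 p.2)^[n] u t‖ ≤ a) (n : ℕ) :
    ∀ t ∈ Icc 0 T, ‖picardFDeriv f f' t₀ u n t p‖ ≤ A := by
  induction n with
  | zero => intro t _; simpa [picardFDeriv] using hA0
  | succ n ih =>
    intro t ht
    rw [picardFDeriv]
    have h := norm_integral_le_mul_of_norm_le ht fun s hs =>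
      (norm_comp_prod_snd_le (D := picardFDeriv f f' t₀ u n s p)
        (hf'L s hs _ (mem_closedBall_zero_iff.2 (hU n s hs)))
        (hf'C s hs _ (mem_closedBall_zero_iff.2 (hU n s hs)))).trans
        (add_le_add_left (mul_le_mul_of_nonneg_left (ih s hs) hL) _)
    have h1 : T * L * A ≤ r * A := by gcongr
    have h2 := ContinuousLinearMap.norm_fst_le ℝ (Euc nx) (Euc nθ)
    refine (norm_add_le _ _).trans ((add_le_add h2 h).trans ?_)
    linarith

/-- The derivatives of the Picard iterates depend on `u` with a factor `n * r ^ n`. -/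
theorem norm_picardFDeriv_sub_le
    (hfc : Continuous fun p : ℝ × Euc nx × Euc nθ => f p.1 p.2.1 p.2.2)
    (hf'c : Continuous fun p : ℝ × Euc nx × Euc nθ => f' p.1 p.2.1 p.2.2)
    {L H r A B A' δ : ℝ} (hT : 0 ≤ T) (hr : T * L ≤ r) (hL : 0 ≤ L) (hH : 0 ≤ H)
    (hδ : 0 ≤ δ) (hr0 : 0 ≤ r) (hA0 : 0 ≤ A) (hB0 : 0 ≤ B) (hA'0 : 0 ≤ A')
    (hB : T * (H * (A + 1)) ≤ r * B) (hA' : T * (H * (A + 1) * (A + 1)) + r * A' ≤ A')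
    {p₁ p₂ : Euc nx × Euc nθ}
    (hf'L : ∀ s ∈ Icc 0 T, ∀ x ∈ closedBall (0 : Euc nx) a,
      ‖(f' (s + t₀) x p₂.2).comp (ContinuousLinearMap.inl ℝ (Euc nx) (Euc nθ))‖ ≤ L)
    (hf'H : ∀ s ∈ Icc 0 T, ∀ x ∈ closedBall (0 : Euc nx) a, ∀ y ∈ closedBall (0 : Euc nx) a,
      ‖f' (s + t₀) x p₁.2 - f' (s + t₀) y p₂.2‖ ≤ H * (‖x - y‖ + ‖p₁.2 - p₂.2‖))
    {u₁ u₂ : ℝ → Euc nx} (hu₁ : Continuous u₁) (hu₂ : Continuous u₂)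
    (hU₁ : ∀ n, ∀ t ∈ Icc 0 T, ‖(picard f t₀ p₁.1 p₁.2)^[n] u₁ t‖ ≤ a)
    (hU₂ : ∀ n, ∀ t ∈ Icc 0 T, ‖(picard f t₀ p₂.1 p₂.2)^[n] u₂ t‖ ≤ a)
    (hU : ∀ n, ∀ t ∈ Icc 0 T,
      ‖(picard f t₀ p₁.1 p₁.2)^[n] u₁ t - (picard f t₀ p₂.1 p₂.2)^[n] u₂ t‖ ≤
        r ^ n * δ + A * (‖p₁.1 - p₂.1‖ + ‖p₁.2 - p₂.2‖))
    (hD₁ : ∀ n, ∀ t ∈ Icc 0 T, ‖picardFDeriv f f' t₀ u₁ n t p₁‖ ≤ A) (n : ℕ) :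
    ∀ t ∈ Icc 0 T, ‖picardFDeriv f f' t₀ u₁ n t p₁ - picardFDeriv f f' t₀ u₂ n t p₂‖ ≤
      n * r ^ n * B * δ + A' * (‖p₁.1 - p₂.1‖ + ‖p₁.2 - p₂.2‖) := by
  induction n with
  | zero =>
    intro t _
    simp only [picardFDeriv, sub_self, norm_zero]
    positivity
  | succ n ih =>
    intro t ht
    have hc : ∀ (p : Euc nx × Euc nθ) {u : ℝ → Euc nx}, Continuous u →
        Continuous fun s => (f' (s + t₀) ((picard f t₀ p.1 p.2)^[n] u s) p.2).comp
          ((picardFDeriv f f' t₀ u n s p).prod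
            (ContinuousLinearMap.snd ℝ (Euc nx) (Euc nθ))) := fun p u hu =>
      (continuous_picardFDeriv_integrand hfc hf'c hu
        (continuous_picardFDeriv hfc hf'c hu n)).comp (Continuous.prodMk_right p)
    simp only [picardFDeriv]
    rw [add_sub_add_left_eq_sub, ← intervalIntegral.integral_sub
      ((hc p₁ hu₁).intervalIntegrable _ _) ((hc p₂ hu₂).intervalIntegrable _ _)]
    set X := ‖p₁.1 - p₂.1‖
    set Y := ‖p₁.2 - p₂.2‖
    have hX : 0 ≤ X := norm_nonneg _
    have hY : 0 ≤ Y := norm_nonneg _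
    have h := norm_integral_le_mul_of_norm_le ht (g := fun s =>
      (f' (s + t₀) ((picard f t₀ p₁.1 p₁.2)^[n] u₁ s) p₁.2).comp
        ((picardFDeriv f f' t₀ u₁ n s p₁).prod (ContinuousLinearMap.snd ℝ (Euc nx) (Euc nθ))) -
      (f' (s + t₀) ((picard f t₀ p₂.1 p₂.2)^[n] u₂ s) p₂.2).comp
        ((picardFDeriv f f' t₀ u₂ n s p₂).prod (ContinuousLinearMap.snd ℝ (Euc nx) (Euc nθ))))
      (C := H * (r ^ n * δ + A * (X + Y) + Y) * (A + 1) +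
        L * (n * r ^ n * B * δ + A' * (X + Y))) fun s hs => by
      have hs₁ := mem_closedBall_zero_iff.2 (hU₁ n s hs)
      have hs₂ := mem_closedBall_zero_iff.2 (hU₂ n s hs)
      have hfd := (hf'H s hs _ hs₁ _ hs₂).trans
        (mul_le_mul_of_nonneg_left (add_le_add_left (hU n s hs) _) hH)
      refine (norm_comp_prod_snd_sub_le (hf'L s hs _ hs₂)).trans ?_
      gcongr
      · exact hD₁ n s hs
      · exact ih s hs
    refine h.trans ?_
    have h1 : T * L * (n * r ^ n * B * δ + A' * (X + Y)) ≤
        r * (n * r ^ n * B * δ + A' * (X + Y)) := by gcongr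
    have h2 : (T * (H * (A + 1) * (A + 1)) + r * A') * (X + Y) ≤ A' * (X + Y) := by gcongr
    have h3 : T * (H * (A + 1)) * (r ^ n * δ) ≤ r * B * (r ^ n * δ) := by gcongr
    have h4 : 0 ≤ T * (H * (A + 1)) * X := by positivity
    rw [pow_succ]
    push_cast
    linarith

/-- A pointwise difference of members of `C_a` is bounded by its sup norm. -/
theorem norm_sub_le_supIcc {u₁ u₂ : ℝ → Euc nx} (h₁ : InCa T a u₁) (h₂ : InCa T a u₂)
    {t : ℝ} (ht : t ∈ Icc 0 T) : ‖u₁ t - u₂ t‖ ≤ supIcc T fun s => u₁ s - u₂ s := by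
  refine le_ciSup (f := fun t : Icc (0:ℝ) T => ‖u₁ t - u₂ t‖) ⟨a + a, ?_⟩ ⟨t, ht⟩
  rintro _ ⟨s, rfl⟩
  exact (norm_sub_le _ _).trans (add_le_add (h₁.2 s s.2) (h₂.2 s s.2))

end Picard

/-- A factor `n * r ^ n` is eventually absorbed by any larger geometric rate. -/
theorem eventually_mul_pow_mul_le_pow {r q : ℝ} (hr : 0 ≤ r) (hrq : r < q) (B : ℝ) :
    ∀ᶠ n : ℕ in atTop, n * r ^ n * B ≤ q ^ n := by
  have hq : 0 < q := hr.trans_lt hrq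
  have h := (tendsto_self_mul_const_pow_of_lt_one (div_nonneg hr hq.le)
    ((div_lt_one hq).2 hrq)).mul_const B
  rw [zero_mul] at h
  filter_upwards [h.eventually (ge_mem_nhds one_pos)] with n hn
  rw [div_pow, mul_div_assoc', div_mul_eq_mul_div, div_le_one (pow_pos hq n)] at hn
  exact hn

/-- **Lipschitz estimate for gradients of Picard iterates with geometrically decaying
dependence on `u`.**  The map `(x,θ,u) ↦ ∇_{x,θ}(P_{t₀,x,θ}u)` is Lipschitz on `X × Θ × C_a`,
and there exist `q < 1`, `K > 0`, `N` such that for all `n ≥ N`: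
`‖∇(P^n_{t₀,x₁,θ₁}u₁) − ∇(P^n_{t₀,x₂,θ₂}u₂)‖_∞ ≤ qⁿ‖u₁−u₂‖_∞ + K‖x₁−x₂‖ + K‖θ₁−θ₂‖`. -/
theorem picard_gradient_lipschitz_decaying {nx nθ : ℕ}
    (Γ : Set ℝ) (X : Set (Euc nx)) (Θ : Set (Euc nθ))
    (hΓ : IsCompact Γ) (hX : IsCompact X) (hΘ : IsCompact Θ)
    (t₀ : ℝ) (ht₀ : t₀ ∈ Γ)
    (f : ℝ → Euc nx → Euc nθ → Euc nx)
    (hfc : Continuous fun p : ℝ × Euc nx × Euc nθ => f p.1 p.2.1 p.2.2)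
    (a Kx M T : ℝ)
    (ha : ∀ x ∈ X, 2 * ‖x‖ ≤ a)
    (hKx : ∀ t ∈ Γ, ∀ θ ∈ Θ, ∀ x ∈ closedBall (0 : Euc nx) a, ∀ y ∈ closedBall (0 : Euc nx) a,
      ‖f t x θ - f t y θ‖ ≤ Kx * ‖x - y‖)
    (hM : ∀ t ∈ Γ, ∀ θ ∈ Θ, ∀ x ∈ closedBall (0 : Euc nx) a, ‖f t x θ‖ ≤ M)
    (hT : 0 < T) (hTK : T * Kx < 1) (hTM : 2 * M * T < a)
    (hsub : Icc t₀ (t₀ + T) ⊆ Γ)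
    -- `f ∈ C¹` in `(x,θ)`, with derivative `f'` jointly continuous and Lipschitz
    (f' : ℝ → Euc nx → Euc nθ → (Euc nx × Euc nθ →L[ℝ] Euc nx))
    (hf' : ∀ t x θ, HasFDerivAt (fun p : Euc nx × Euc nθ => f t p.1 p.2) (f' t x θ) (x, θ))
    (hf'c : Continuous fun p : ℝ × Euc nx × Euc nθ => f' p.1 p.2.1 p.2.2)
    (Kf : ℝ)
    (hf'lip : ∀ t ∈ Γ, ∀ x₁ ∈ closedBall (0 : Euc nx) a, ∀ x₂ ∈ closedBall (0 : Euc nx) a,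
      ∀ θ₁ ∈ Θ, ∀ θ₂ ∈ Θ, ‖f' t x₁ θ₁ - f' t x₂ θ₂‖ ≤ Kf * (‖x₁ - x₂‖ + ‖θ₁ - θ₂‖))
    -- `S u n t (x,θ)` is the derivative of `(x,θ) ↦ (P^n_{t₀,x,θ} u)(t)`
    (S : (ℝ → Euc nx) → ℕ → ℝ → Euc nx × Euc nθ → (Euc nx × Euc nθ →L[ℝ] Euc nx))
    (hS : ∀ u, InCa T a u → ∀ n, ∀ t ∈ Icc (0:ℝ) T, ∀ x ∈ X, ∀ θ ∈ Θ,
      HasFDerivAt (fun p : Euc nx × Euc nθ => (picard f t₀ p.1 p.2)^[n] u t)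
        (S u n t (x, θ)) (x, θ)) :
    -- `(x,θ,u) ↦ ∇_{x,θ}(P_{t₀,x,θ}u)` is Lipschitz continuous on `X × Θ × C_a`
    (∃ K₀ : ℝ, ∀ u₁, InCa T a u₁ → ∀ u₂, InCa T a u₂ →
      ∀ x₁ ∈ X, ∀ x₂ ∈ X, ∀ θ₁ ∈ Θ, ∀ θ₂ ∈ Θ, ∀ t ∈ Icc (0:ℝ) T,
        ‖S u₁ 1 t (x₁, θ₁) - S u₂ 1 t (x₂, θ₂)‖
          ≤ K₀ * (‖x₁ - x₂‖ + ‖θ₁ - θ₂‖ + supIcc T (fun s => u₁ s - u₂ s))) ∧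
    -- geometrically decaying dependence on `u` for high-order iterates
    (∃ q : ℝ, ∃ K : ℝ, ∃ N : ℕ, 0 ≤ q ∧ q < 1 ∧ 0 < K ∧
      ∀ n ≥ N, ∀ u₁, InCa T a u₁ → ∀ u₂, InCa T a u₂ →
        ∀ x₁ ∈ X, ∀ x₂ ∈ X, ∀ θ₁ ∈ Θ, ∀ θ₂ ∈ Θ, ∀ t ∈ Icc (0:ℝ) T,
          ‖S u₁ n t (x₁, θ₁) - S u₂ n t (x₂, θ₂)‖
            ≤ q ^ n * supIcc T (fun s => u₁ s - u₂ s)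
              + K * ‖x₁ - x₂‖ + K * ‖θ₁ - θ₂‖) := by
  rcases X.eq_empty_or_nonempty with rfl | ⟨x₀, hx₀⟩
  · exact ⟨⟨0, by simp⟩, 0, 1, 0, by simp⟩
  rcases Θ.eq_empty_or_nonempty with rfl | ⟨θ₀, hθ₀⟩
  · exact ⟨⟨0, by simp⟩, 0, 1, 0, by simp⟩
  have hshift : ∀ s ∈ Icc 0 T, s + t₀ ∈ Γ := fun s hs =>
    hsub ⟨by linarith [hs.1], by linarith [hs.2]⟩
  have ha0 : 0 ≤ a := (by positivity : 0 ≤ 2 * ‖x₀‖).trans (ha x₀ hx₀)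
  have hM0 : 0 ≤ M := (norm_nonneg _).trans
    (hM t₀ ht₀ θ₀ hθ₀ 0 (mem_closedBall_self ha0))
  have hapos : 0 < a := (by positivity : 0 ≤ 2 * M * T).trans_lt hTM
  obtain ⟨R, hR⟩ := hΘ.isBounded.subset_closedBall (0 : Euc nθ)
  obtain ⟨C, hC⟩ := (hΓ.prod ((isCompact_closedBall (0 : Euc nx) a).prod
    (isCompact_closedBall (0 : Euc nθ) R))).exists_bound_of_continuousOn hf'c.continuousOn
  have hC' : ∀ t ∈ Γ, ∀ x ∈ closedBall (0 : Euc nx) a, ∀ θ ∈ closedBall (0 : Euc nθ) R,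
      ‖f' t x θ‖ ≤ C := fun t ht x hx θ hθ => hC (t, x, θ) ⟨ht, hx, hθ⟩
  have hC0 : 0 ≤ C := (norm_nonneg _).trans
    (hC' t₀ ht₀ 0 (mem_closedBall_self ha0) θ₀ (hR hθ₀))
  set L := max Kx 0
  set H := max Kf 0
  have hL0 : 0 ≤ L := le_max_right _ _
  have hH0 : 0 ≤ H := le_max_right _ _
  have hTL : T * L < 1 := by
    rcases max_cases Kx 0 with h | h <;> simp only [L, h.1]
    · exact hTK
    · simp
  have hlip : ∀ t ∈ Γ, ∀ θ ∈ Θ, ∀ x ∈ closedBall (0 : Euc nx) a,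
      ∀ y ∈ closedBall (0 : Euc nx) a, ‖f t x θ - f t y θ‖ ≤ L * ‖x - y‖ :=
    fun t ht θ hθ x hx y hy => (hKx t ht θ hθ x hx y hy).trans
      (mul_le_mul_of_nonneg_right (le_max_left _ _) (norm_nonneg _))
  have hf'L : ∀ t ∈ Γ, ∀ θ ∈ Θ, ∀ x ∈ closedBall (0 : Euc nx) a,
      ‖(f' t x θ).comp (ContinuousLinearMap.inl ℝ (Euc nx) (Euc nθ))‖ ≤ L :=
    fun t ht θ hθ x hx => norm_comp_inl_le_of_lipschitz hL0 hapos.ne' (fun y => hf' t y θ)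
      (hf'c.comp (continuous_const.prodMk (continuous_id.prodMk continuous_const)))
      (hlip t ht θ hθ) hx
  obtain ⟨r, hr, hr1⟩ := exists_between hTL
  have hr0 : 0 < r := (by positivity : 0 ≤ T * L).trans_lt hr
  have h1r : 0 < 1 - r := sub_pos.2 hr1
  obtain ⟨A, hA0, hA⟩ : ∃ A, 0 ≤ A ∧ 1 + T * C + r * A ≤ A := by
    refine ⟨(1 + T * C) / (1 - r), by positivity, le_of_eq ?_⟩
    field_simp
    ring
  obtain ⟨B, hB0, hB⟩ : ∃ B, 0 ≤ B ∧ T * (H * (A + 1)) ≤ r * B :=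
    ⟨T * (H * (A + 1)) / r, by positivity, le_of_eq (by field_simp)⟩
  obtain ⟨A', hA'0, hA'⟩ : ∃ A', 0 ≤ A' ∧ T * (H * (A + 1) * (A + 1)) + r * A' ≤ A' := by
    refine ⟨T * (H * (A + 1) * (A + 1)) / (1 - r), by positivity, le_of_eq ?_⟩
    field_simp
    ring
  have key : ∀ n : ℕ, ∀ u₁, InCa T a u₁ → ∀ u₂, InCa T a u₂ →
      ∀ x₁ ∈ X, ∀ x₂ ∈ X, ∀ θ₁ ∈ Θ, ∀ θ₂ ∈ Θ, ∀ t ∈ Icc (0:ℝ) T,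
        ‖S u₁ n t (x₁, θ₁) - S u₂ n t (x₂, θ₂)‖ ≤
          n * r ^ n * B * supIcc T (fun s => u₁ s - u₂ s) +
            A' * (‖x₁ - x₂‖ + ‖θ₁ - θ₂‖) := by
    intro n u₁ h₁ u₂ h₂ x₁ hx₁ x₂ hx₂ θ₁ hθ₁ θ₂ hθ₂ t ht
    let ext : (ℝ → Euc nx) → ℝ → Euc nx := fun u => IccExtend hT.le ((Icc 0 T).domRestrict u)
    have hext : ∀ u, EqOn u (ext u) (Icc 0 T) := fun u s hs =>
      (IccExtend_of_mem hT.le ((Icc 0 T).domRestrict u) hs).symm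
    have hextc : ∀ u, InCa T a u → Continuous (ext u) := fun u hu =>
      (continuousOn_iff_continuous_domRestrict.1 hu.1).Icc_extend'
    have hSD : ∀ u, InCa T a u → ∀ x ∈ X, ∀ θ ∈ Θ,
        S u n t (x, θ) = picardFDeriv f f' t₀ (ext u) n t (x, θ) := by
      intro u hu x hx θ hθ
      have h := hasFDerivAt_picard_iterate (t₀ := t₀) hfc hf' hf'c (hextc u hu) n t (x, θ)
      simp only [← picard_iterate_eqOn (hext u) n ht] at h
      exact (hS u hu n t ht x hx θ hθ).unique h
    have hbd : ∀ u, InCa T a u → ∀ x ∈ X, ∀ θ ∈ Θ, ∀ n, ∀ t ∈ Icc 0 T,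
        ‖(picard f t₀ x θ)^[n] (ext u) t‖ ≤ a := fun u hu x hx θ hθ =>
      norm_picard_iterate_le (ha x hx) hTM (fun s hs => hM _ (hshift s hs) θ hθ)
        fun s hs => hext u hs ▸ hu.2 s hs
    have hδ : ∀ s ∈ Icc 0 T, ‖ext u₁ s - ext u₂ s‖ ≤ supIcc T fun s => u₁ s - u₂ s :=
      fun s hs => by
        rw [← hext u₁ hs, ← hext u₂ hs]
        exact norm_sub_le_supIcc h₁ h₂ hs
    have hδ0 : 0 ≤ supIcc T fun s => u₁ s - u₂ s := (norm_nonneg _).trans (hδ t ht)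
    rw [hSD u₁ h₁ x₁ hx₁ θ₁ hθ₁, hSD u₂ h₂ x₂ hx₂ θ₂ hθ₂]
    have hU := norm_picard_iterate_sub_le (p₁ := (x₁, θ₁)) (p₂ := (x₂, θ₂)) hfc hT.le hr.le hL0
      hC0 hδ0 hr0.le hA0 hA
      (fun s hs x hx y hy => by
        have e1 := hlip _ (hshift s hs) θ₁ hθ₁ x hx y hy
        have e2 := norm_sub_le_of_norm_fderiv_le (fun θ => hf' (s + t₀) y θ)
          (hC' _ (hshift s hs) y hy) (hR hθ₁) (hR hθ₂)
        exact (norm_sub_le_norm_sub_add_norm_sub _ _ _).trans (add_le_add e1 e2))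
      (hextc u₁ h₁) (hextc u₂ h₂) (hbd u₁ h₁ x₁ hx₁ θ₁ hθ₁) (hbd u₂ h₂ x₂ hx₂ θ₂ hθ₂) hδ
    have hD := norm_picardFDeriv_le (p := (x₁, θ₁)) hr.le hL0 hA0 hA
      (fun s hs => hf'L _ (hshift s hs) θ₁ hθ₁)
      (fun s hs x hx => hC' _ (hshift s hs) x hx θ₁ (hR hθ₁)) (hbd u₁ h₁ x₁ hx₁ θ₁ hθ₁)
    exact norm_picardFDeriv_sub_le (p₁ := (x₁, θ₁)) (p₂ := (x₂, θ₂)) hfc hf'c hT.le hr.le hL0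
      hH0 hδ0 hr0.le hA0 hB0 hA'0 hB hA' (fun s hs => hf'L _ (hshift s hs) θ₂ hθ₂)
      (fun s hs x hx y hy =>
        (hf'lip _ (hshift s hs) x hx y hy θ₁ hθ₁ θ₂ hθ₂).trans
          (mul_le_mul_of_nonneg_right (le_max_left _ _) (by positivity)))
      (hextc u₁ h₁) (hextc u₂ h₂) (hbd u₁ h₁ x₁ hx₁ θ₁ hθ₁) (hbd u₂ h₂ x₂ hx₂ θ₂ hθ₂)
      hU hD n t ht
  have hsup0 : ∀ v : ℝ → Euc nx, 0 ≤ supIcc T v := fun v =>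
    Real.iSup_nonneg fun _ => norm_nonneg _
  constructor
  · refine ⟨r * B + A', fun u₁ h₁ u₂ h₂ x₁ hx₁ x₂ hx₂ θ₁ hθ₁ θ₂ hθ₂ t ht =>
      (key 1 u₁ h₁ u₂ h₂ x₁ hx₁ x₂ hx₂ θ₁ hθ₁ θ₂ hθ₂ t ht).trans ?_⟩
    have e1 : 0 ≤ r * B * (‖x₁ - x₂‖ + ‖θ₁ - θ₂‖) := by positivity
    have e2 := mul_nonneg hA'0 (hsup0 fun s => u₁ s - u₂ s)
    rw [Nat.cast_one, one_mul, pow_one]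
    linarith
  · obtain ⟨q, hrq, hq1⟩ := exists_between hr1
    obtain ⟨N, hN⟩ := eventually_atTop.1 (eventually_mul_pow_mul_le_pow hr0.le hrq B)
    refine ⟨q, A' + 1, N, (hr0.trans hrq).le, hq1, by positivity, ?_⟩
    intro n hn u₁ h₁ u₂ h₂ x₁ hx₁ x₂ hx₂ θ₁ hθ₁ θ₂ hθ₂ t ht
    refine (key n u₁ h₁ u₂ h₂ x₁ hx₁ x₂ hx₂ θ₁ hθ₁ θ₂ hθ₂ t ht).trans ?_
    have e1 := mul_le_mul_of_nonneg_right (hN n hn) (hsup0 fun s => u₁ s - u₂ s)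
    linarith [norm_nonneg (x₁ - x₂), norm_nonneg (θ₁ - θ₂)]
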